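/- Let e ≥ 4 be an integer, q a positive integer, m = e + 2q + 1, d a positive integer with gcd(m, d) = 1, and let Γ = Γ_{(e,q,d)}(𝒮) be the additive submonoid of ℕ generated by 𝒮 = {m, m+d} ∪ {(q+1)m + (q+i)d : 2 ≤ i ≤ e−1}. Then the Apéry set Ap(Γ, m) = {s ∈ Γ : s − m ∉ Γ} equals β_1 ∪ β_2 ∪ β_3, where β_1 = {k(m+d) : 0 ≤ k ≤ q+1}, β_2 = {k(m+d) + (q+1)m + (q+e−1)d : 0 ≤ k ≤ q+1}, and β_3 = {(q+1)m + (q+i)d : 2 ≤ i ≤ e−2}. -/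

import Mathlib

def wt (e q b : ℕ) : ℕ := min b (q + 1) + (b - (q + e - 1))

theorem wt_add (e q d m a b a' b' : ℕ) (he : 4 ≤ e) (hm : m = e + 2 * q + 1) (hd : 0 < d)
    (hb : b < m) (hb' : b' < m) (ha : wt e q b ≤ a) (ha' : wt e q b' ≤ a') :
    ∃ A B, B < m ∧ wt e q B ≤ A ∧ (a * m + b * d) + (a' * m + b' * d) = A * m + B * d := by
  unfold wt at *
  by_cases h : b + b' < m
  · exact ⟨a + a', b + b', h, by omega, by ring⟩
  · obtain ⟨r, hr⟩ : ∃ r, b + b' = m + r := ⟨b + b' - m, by omega⟩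
    refine ⟨a + a' + d, r, by omega, by omega, ?_⟩
    calc (a * m + b * d) + (a' * m + b' * d) = (a + a') * m + (b + b') * d := by ring
      _ = _ := by rw [hr]; ring

theorem statement9 (e q d m : ℕ) (he : 4 ≤ e) (hq : 0 < q) (hm : m = e + 2 * q + 1)
    (hd : 0 < d) (hgcd : Nat.gcd m d = 1)
    (Γ : AddSubmonoid ℕ)
    (hΓ : Γ = AddSubmonoid.closure ({m, m + d} ∪
      {x : ℕ | ∃ i : ℕ, 2 ≤ i ∧ i ≤ e - 1 ∧ x = (q + 1) * m + (q + i) * d})) :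
    {s : ℕ | s ∈ Γ ∧ ¬ ∃ t ∈ Γ, s = t + m} =
      {x : ℕ | ∃ kk : ℕ, kk ≤ q + 1 ∧ x = kk * (m + d)} ∪
      {x : ℕ | ∃ kk : ℕ, kk ≤ q + 1 ∧ x = kk * (m + d) + (q + 1) * m + (q + e - 1) * d} ∪
      {x : ℕ | ∃ i : ℕ, 2 ≤ i ∧ i ≤ e - 2 ∧ x = (q + 1) * m + (q + i) * d} := by
  have hmΓ : m ∈ Γ := by
    rw [hΓ]; exact AddSubmonoid.subset_closure (by simp)
  have hmdΓ : m + d ∈ Γ := by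
    rw [hΓ]; exact AddSubmonoid.subset_closure (by simp)
  have hgΓ : ∀ i, 2 ≤ i → i ≤ e - 1 → (q + 1) * m + (q + i) * d ∈ Γ := by
    intro i h1 h2
    rw [hΓ]; exact AddSubmonoid.subset_closure (Or.inr ⟨i, h1, h2, rfl⟩)
  have hmul : ∀ k x, x ∈ Γ → k * x ∈ Γ := by
    intro k x hx
    have := Γ.nsmul_mem hx k
    simpa using this
  -- the right-hand side consists of the minimal elements
  have hR : ∀ s, (s ∈ {x : ℕ | ∃ kk : ℕ, kk ≤ q + 1 ∧ x = kk * (m + d)} ∪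
      {x : ℕ | ∃ kk : ℕ, kk ≤ q + 1 ∧ x = kk * (m + d) + (q + 1) * m + (q + e - 1) * d} ∪
      {x : ℕ | ∃ i : ℕ, 2 ≤ i ∧ i ≤ e - 2 ∧ x = (q + 1) * m + (q + i) * d}) ↔
      ∃ b, b < m ∧ s = wt e q b * m + b * d := by
    intro s
    constructor
    · rintro ((⟨k, hk, rfl⟩ | ⟨k, hk, rfl⟩) | ⟨i, h1, h2, rfl⟩)
      · refine ⟨k, by omega, ?_⟩
        have : wt e q k = k := by unfold wt; omega
        rw [this]; ring
      · refine ⟨k + (q + e - 1), by omega, ?_⟩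
        have : wt e q (k + (q + e - 1)) = k + (q + 1) := by unfold wt; omega
        rw [this]; ring
      · refine ⟨q + i, by omega, ?_⟩
        have : wt e q (q + i) = q + 1 := by unfold wt; omega
        rw [this]
    · rintro ⟨b, hb, rfl⟩
      by_cases h1 : b ≤ q + 1
      · refine Or.inl (Or.inl ⟨b, h1, ?_⟩)
        have : wt e q b = b := by unfold wt; omega
        rw [this]; ring
      · by_cases h2 : b < q + e - 1
        · obtain ⟨i, rfl⟩ : ∃ i, b = q + i := ⟨b - q, by omega⟩
          refine Or.inr ⟨i, by omega, by omega, ?_⟩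
          have : wt e q (q + i) = q + 1 := by unfold wt; omega
          rw [this]
        · obtain ⟨k, rfl⟩ : ∃ k, b = k + (q + e - 1) := ⟨b - (q + e - 1), by omega⟩
          refine Or.inl (Or.inr ⟨k, by omega, ?_⟩)
          have : wt e q (k + (q + e - 1)) = k + (q + 1) := by unfold wt; omega
          rw [this]; ring
  have hRΓ : ∀ b, b < m → wt e q b * m + b * d ∈ Γ := by
    intro b hb
    rcases (hR _).2 ⟨b, hb, rfl⟩ with (⟨k, hk, h⟩ | ⟨k, hk, h⟩) | ⟨i, h1, h2, h⟩
    · rw [h]; exact hmul _ _ hmdΓ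
    · rw [h, add_assoc]
      refine Γ.add_mem (hmul _ _ hmdΓ) ?_
      have := hgΓ (e - 1) (by omega) le_rfl
      rwa [show q + (e - 1) = q + e - 1 by omega] at this
    · rw [h]; exact hgΓ i h1 (by omega)
  have hP : ∀ s ∈ Γ, ∃ a b, b < m ∧ wt e q b ≤ a ∧ s = a * m + b * d := by
    intro s hs
    rw [hΓ] at hs
    induction hs using AddSubmonoid.closure_induction with
    | mem x hx =>
      rcases hx with (rfl | hx) | ⟨i, h1, h2, rfl⟩
      · exact ⟨1, 0, by omega, by unfold wt; omega, by ring⟩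
      · rw [Set.mem_singleton_iff] at hx
        exact ⟨1, 1, by omega, by unfold wt; omega, by rw [hx]; ring⟩
      · exact ⟨q + 1, q + i, by omega, by unfold wt; omega, rfl⟩
    | zero => exact ⟨0, 0, by omega, by unfold wt; omega, by ring⟩
    | add x y _ _ hx hy =>
      obtain ⟨a, b, h1, h2, rfl⟩ := hx
      obtain ⟨a', b', h1', h2', rfl⟩ := hy
      exact wt_add e q d m a b a' b' he hm hd h1 h1' h2 h2'
  ext s
  rw [hR]
  constructor
  · rintro ⟨hs, hn⟩
    obtain ⟨a, b, hb, hw, rfl⟩ := hP s hs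
    refine ⟨b, hb, ?_⟩
    rcases hw.eq_or_lt with h | h
    · rw [h]
    · exfalso
      apply hn
      obtain ⟨c, rfl⟩ : ∃ c, a = c + wt e q b + 1 := ⟨a - wt e q b - 1, by omega⟩
      exact ⟨c * m + (wt e q b * m + b * d), Γ.add_mem (hmul _ _ hmΓ) (hRΓ b hb), by ring⟩
  · rintro ⟨b, hb, rfl⟩
    refine ⟨hRΓ b hb, ?_⟩
    rintro ⟨t, ht, h⟩
    obtain ⟨a, b', hb', hw, rfl⟩ := hP t ht
    have hmod : b * d ≡ b' * d [MOD m] := by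
      have := congrArg (· % m) h
      simp only [Nat.add_mod_right, Nat.mul_add_mod_self_right] at this
      exact this
    have hbb : b ≡ b' [MOD m] := Nat.ModEq.cancel_right_of_coprime hgcd hmod
    have hbe : b = b' := Nat.ModEq.eq_of_lt_of_lt hbb hb hb'
    subst hbe
    have : wt e q b * m = (a + 1) * m := by linarith
    have := Nat.eq_of_mul_eq_mul_right (by omega) this
    omega
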